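/- (Theorem 4.1) Let G be an IMM execution graph such that po;[W^rel] ⊆ po^?;[F^rel];po ∪ rmw (every release write is preceded by a release fence, or is the write part of an RMW pair). Let G' be the IMM execution graph obtained from G by weakening the mode of every release write label to rlx (all other components unchanged). Then IMM-consistency of G' implies IMM-consistency of G. -/

import Mathlib

/-! ## Basic definitions: events, labels, relations -/

abbrev Loc := ℕ
abbrev Val := ℕ

inductive Mode
  | rlx | acq | rel | acqrel | sc
deriving DecidableEq

inductive ExFlag
  | notex | ex
deriving DecidableEq

inductive Strength
  | normal | strong
deriving DecidableEq

inductive Label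
  | read (o : Mode) (x : Loc) (v : Val) (s : ExFlag)
  | write (o : Mode) (x : Loc) (v : Val) (st : Strength)
  | fence (o : Mode)
deriving DecidableEq

inductive Event
  | init (x : Loc)
  | ev (tid : ℕ) (sn : ℚ)
deriving DecidableEq

def Event.isInit : Event → Prop
  | .init _ => True
  | .ev _ _ => False

/-- the set of initialization events -/
def InitE : Set Event := {e | e.isInit}

/-- the `sequenced-before` partial order on events: initialization events precede all
non-initialization events, and events of the same thread are ordered by serial number -/
def evLt : Event → Event → Prop
  | .init _, .ev _ _ => True
  | .ev i n, .ev j m => i = j ∧ n < m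
  | _, _ => False

abbrev REv := Event → Event → Prop

/-- relational composition `r ; s` -/
def seqR (r s : REv) : REv := fun a c => ∃ b, r a b ∧ s b c

infixr:70 " ⬝ " => seqR

/-- identity relation on a set: `[A]` -/
def eqv (A : Set Event) : REv := fun a b => a = b ∧ a ∈ A

notation:max "⦗" A "⦘" => eqv A

/-- union of relations -/
def runion (r s : REv) : REv := fun a b => r a b ∨ s a b

infixl:65 " ∪ᵣ " => runion

/-- reflexive closure `r^?` -/
def rcl (r : REv) : REv := fun a b => a = b ∨ r a b

/-- transitive closure `r⁺` -/
def tcl (r : REv) : REv := Relation.TransGen r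

/-- reflexive-transitive closure `r*` -/
def rtcl (r : REv) : REv := Relation.ReflTransGen r

/-- inverse relation `r⁻¹` -/
def transp (r : REv) : REv := fun a b => r b a

def rdom (r : REv) : Set Event := {a | ∃ b, r a b}

def rcodom (r : REv) : Set Event := {b | ∃ a, r a b}

/-- immediate edges: `imm(r) = r ∖ r;r` -/
def immediate (r : REv) : REv := fun a b => r a b ∧ ¬ (r ⬝ r) a b

def acyclic (r : REv) : Prop := Irreflexive (tcl r)

/-- `r` totally orders `A` -/
def totalOn (A : Set Event) (r : REv) : Prop :=
  ∀ a ∈ A, ∀ b ∈ A, a ≠ b → r a b ∨ r b a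

def Label.locOf : Label → Option Loc
  | .read _ x _ _ => some x
  | .write _ x _ _ => some x
  | .fence _ => none

def Label.valOf : Label → Option Val
  | .read _ _ v _ => some v
  | .write _ _ v _ => some v
  | .fence _ => none

/-! ## IMM execution graphs -/

structure Execution where
  E : Set Event
  lab : Event → Label
  rmw : REv
  data : REv
  addr : REv
  ctrl : REv
  casdep : REv
  rf : REv
  co : REv

namespace Execution

variable (G : Execution)

def loc (e : Event) : Option Loc := (G.lab e).locOf
def valu (e : Event) : Option Val := (G.lab e).valOf

/-- read events -/
def R : Set Event := {e | e ∈ G.E ∧ ∃ o x v s, G.lab e = .read o x v s}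
/-- write events -/
def W : Set Event := {e | e ∈ G.E ∧ ∃ o x v st, G.lab e = .write o x v st}
/-- fence events -/
def F : Set Event := {e | e ∈ G.E ∧ ∃ o, G.lab e = .fence o}
/-- acquire reads -/
def Racq : Set Event := {e | e ∈ G.E ∧ ∃ x v s, G.lab e = .read .acq x v s}
/-- exclusive reads -/
def Rex : Set Event := {e | e ∈ G.E ∧ ∃ o x v, G.lab e = .read o x v .ex}
/-- release writes -/
def Wrel : Set Event := {e | e ∈ G.E ∧ ∃ x v st, G.lab e = .write .rel x v st}
/-- strong writes -/
def Wstrong : Set Event := {e | e ∈ G.E ∧ ∃ o x v, G.lab e = .write o x v .strong}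
/-- writes to location `x` -/
def Wloc (x : Loc) : Set Event := {e | e ∈ G.W ∧ G.loc e = some x}
/-- reads from location `x` -/
def Rloc (x : Loc) : Set Event := {e | e ∈ G.R ∧ G.loc e = some x}
/-- SC fences -/
def Fsc : Set Event := {e | e ∈ G.E ∧ G.lab e = .fence .sc}
/-- fences of mode exactly `rel` -/
def Frel : Set Event := {e | e ∈ G.E ∧ G.lab e = .fence .rel}
/-- fences whose mode is at least `rel` (i.e. `rel`, `acqrel` or `sc`) -/
def FgeRel : Set Event :=
  {e | e ∈ G.E ∧ (G.lab e = .fence .rel ∨ G.lab e = .fence .acqrel ∨ G.lab e = .fence .sc)}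
/-- fences whose mode is at least `acq` (i.e. `acq`, `acqrel` or `sc`) -/
def FgeAcq : Set Event :=
  {e | e ∈ G.E ∧ (G.lab e = .fence .acq ∨ G.lab e = .fence .acqrel ∨ G.lab e = .fence .sc)}

/-- program order -/
def po : REv := fun a b => a ∈ G.E ∧ b ∈ G.E ∧ evLt a b

/-- both events access the same location -/
def sameLoc : REv := fun a b => ∃ x, G.loc a = some x ∧ G.loc b = some x

/-- `po|loc` -/
def poloc : REv := fun a b => G.po a b ∧ G.sameLoc a b

def rfi : REv := fun a b => G.rf a b ∧ G.po a b
def rfe : REv := fun a b => G.rf a b ∧ ¬ G.po a b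
def coi : REv := fun a b => G.co a b ∧ G.po a b
def coe : REv := fun a b => G.co a b ∧ ¬ G.po a b

/-- from-read -/
def fr : REv := transp G.rf ⬝ G.co
def fri : REv := fun a b => G.fr a b ∧ G.po a b
def fre : REv := fun a b => G.fr a b ∧ ¬ G.po a b

/-- release sequence -/
def rs : REv :=
  ⦗G.W⦘ ⬝ G.poloc ⬝ ⦗G.W⦘ ∪ᵣ ⦗G.W⦘ ⬝ rtcl (rcl G.poloc ⬝ G.rf ⬝ G.rmw)

/-- release prefix -/
def release : REv := (⦗G.Wrel⦘ ∪ᵣ ⦗G.FgeRel⦘ ⬝ G.po) ⬝ G.rs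

/-- synchronizes with -/
def sw : REv :=
  G.release ⬝ (G.rfi ∪ᵣ rcl G.poloc ⬝ G.rfe) ⬝ (⦗G.Racq⦘ ∪ᵣ G.po ⬝ ⦗G.FgeAcq⦘)

/-- happens-before -/
def hb : REv := tcl (G.po ∪ᵣ G.sw)

/-- extended coherence order -/
def eco : REv := G.rf ∪ᵣ G.co ⬝ rcl G.rf ∪ᵣ G.fr ⬝ rcl G.rf

/-- barrier order -/
def bob : REv :=
  G.po ⬝ ⦗G.Wrel⦘ ∪ᵣ ⦗G.Racq⦘ ⬝ G.po ∪ᵣ G.po ⬝ ⦗G.F⦘ ∪ᵣ ⦗G.F⦘ ⬝ G.po ∪ᵣ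
    ⦗G.Wrel⦘ ⬝ G.poloc ⬝ ⦗G.W⦘

/-- syntactic dependencies -/
def deps : REv :=
  G.data ∪ᵣ G.ctrl ∪ᵣ G.addr ⬝ rcl G.po ∪ᵣ G.casdep ∪ᵣ ⦗G.Rex⦘ ⬝ G.po

/-- preserved program order -/
def ppo : REv := ⦗G.R⦘ ⬝ tcl (G.deps ∪ᵣ G.rfi) ⬝ ⦗G.W⦘

def detour : REv := fun a b => (G.coe ⬝ G.rfe) a b ∧ G.po a b

/-- partial SC fence order -/
def psc : REv := ⦗G.Fsc⦘ ⬝ G.hb ⬝ G.eco ⬝ G.hb ⬝ ⦗G.Fsc⦘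

/-- the acyclicity relation of IMM -/
def ar : REv :=
  G.rfe ∪ᵣ G.bob ∪ᵣ G.ppo ∪ᵣ G.detour ∪ᵣ G.psc ∪ᵣ ⦗G.Wstrong⦘ ⬝ G.po ⬝ ⦗G.W⦘

/-! RC11-style variants -/

def rsRC11 : REv := ⦗G.W⦘ ⬝ rcl G.poloc ⬝ rtcl (G.rf ⬝ G.rmw)

def releaseRC11 : REv := (⦗G.Wrel⦘ ∪ᵣ ⦗G.FgeRel⦘ ⬝ G.po) ⬝ G.rsRC11

def swRC11 : REv := G.releaseRC11 ⬝ G.rf ⬝ (⦗G.Racq⦘ ∪ᵣ G.po ⬝ ⦗G.FgeAcq⦘)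

def hbRC11 : REv := tcl (G.po ∪ᵣ G.swRC11)

end Execution

/-- Well-formedness of an IMM execution graph -/
structure ExecWf (G : Execution) : Prop where
  finE : G.E.Finite
  init_lab : ∀ x, Event.init x ∈ G.E →
    G.lab (Event.init x) = Label.write .rlx x 0 .normal
  read_mode : ∀ e ∈ G.E, ∀ o x v s, G.lab e = .read o x v s → o = Mode.rlx ∨ o = Mode.acq
  write_mode : ∀ e ∈ G.E, ∀ o x v st, G.lab e = .write o x v st → o = Mode.rlx ∨ o = Mode.rel
  fence_mode : ∀ e ∈ G.E, ∀ o, G.lab e = .fence o →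
    o = Mode.acq ∨ o = Mode.rel ∨ o = Mode.acqrel ∨ o = Mode.sc
  rmw_sub : ∀ a b, G.rmw a b → a ∈ G.Rex ∧ b ∈ G.W ∧ G.sameLoc a b ∧ immediate G.po a b
  strong_rmw : G.Wstrong ⊆ rcodom G.rmw
  data_sub : ∀ a b, G.data a b → a ∈ G.R ∧ G.po a b ∧ b ∈ G.W
  addr_sub : ∀ a b, G.addr a b → a ∈ G.R ∧ G.po a b ∧ (b ∈ G.R ∨ b ∈ G.W)
  ctrl_sub : ∀ a b, G.ctrl a b → a ∈ G.R ∧ G.po a b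
  ctrl_po : ∀ a b c, G.ctrl a b → G.po b c → G.ctrl a c
  casdep_sub : ∀ a b, G.casdep a b → a ∈ G.R ∧ G.po a b ∧ b ∈ G.Rex
  rf_sub : ∀ a b, G.rf a b → a ∈ G.W ∧ b ∈ G.R ∧ G.sameLoc a b
  rf_val : ∀ a b, G.rf a b → G.valu a = G.valu b
  rf_func : ∀ a b c, G.rf a c → G.rf b c → a = b
  co_sub : ∀ a b, G.co a b → a ∈ G.W ∧ b ∈ G.W ∧ G.sameLoc a b
  co_trans : Transitive G.co
  co_irr : Irreflexive G.co

/-- IMM-consistency (Definition 3.1) -/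
def IMMConsistent (G : Execution) : Prop :=
  rcodom G.rf = G.R ∧
  (∀ x, totalOn (G.Wloc x) G.co) ∧
  Irreflexive (G.hb ⬝ rcl G.eco) ∧
  (∀ a b, G.rmw a b → ¬ (G.fre ⬝ G.coe) a b) ∧
  acyclic G.ar

/-- Weakening of a label: release write labels become relaxed, all others unchanged. -/
def weakenRelWrite : Label → Label
  | Label.write Mode.rel x v st => Label.write Mode.rlx x v st
  | l => l

theorem rcl_trans {r : REv} (hr : ∀ a b c, r a b → r b c → r a c) {a b c : Event}
    (hab : rcl r a b) (hbc : rcl r b c) : rcl r a c := by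
  rcases hab with rfl | hab
  · exact hbc
  · rcases hbc with rfl | hbc
    · exact Or.inr hab
    · exact Or.inr (hr _ _ _ hab hbc)

theorem rcl_mono {r s : REv} (hrs : ∀ a b, r a b → s a b) {a b : Event} (h : rcl r a b) :
    rcl s a b :=
  h.imp id (hrs a b)

theorem tcl_of_head_rcl {r : REv} {a b c : Event} (hab : rcl r a b) (hbc : tcl r b c) :
    tcl r a c := by
  rcases hab with rfl | hab
  · exact hbc
  · exact Relation.TransGen.head hab hbc

theorem evLt_trans : ∀ {a b c : Event}, evLt a b → evLt b c → evLt a c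
  | .init _, .ev _ _, .ev _ _, _, _ => trivial
  | .ev _ _, .ev _ _, .ev _ _, ⟨h₁, h₂⟩, ⟨h₃, h₄⟩ => ⟨h₁.trans h₃, h₂.trans h₄⟩

theorem evLt_irrefl : ∀ a : Event, ¬ evLt a a
  | .init _, h => h
  | .ev _ _, h => lt_irrefl _ h.2

namespace Execution

variable {G : Execution}

/-! ### Elementary facts about execution graphs -/

theorem po_trans {a b c : Event} (hab : G.po a b) (hbc : G.po b c) : G.po a c :=
  ⟨hab.1, hbc.2.1, evLt_trans hab.2.2 hbc.2.2⟩

theorem po_irrefl (a : Event) : ¬ G.po a a := fun h => evLt_irrefl a h.2.2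

theorem sameLoc_trans {a b c : Event} (hab : G.sameLoc a b) (hbc : G.sameLoc b c) :
    G.sameLoc a c := by
  obtain ⟨x, ha, hb⟩ := hab
  obtain ⟨y, hb', hc⟩ := hbc
  exact ⟨x, ha, by rw [hc, ← hb', hb]⟩

theorem poloc_trans {a b c : Event} (hab : G.poloc a b) (hbc : G.poloc b c) : G.poloc a c :=
  ⟨po_trans hab.1 hbc.1, sameLoc_trans hab.2 hbc.2⟩

theorem hb_trans {a b c : Event} (hab : G.hb a b) (hbc : G.hb b c) : G.hb a c :=
  Relation.TransGen.trans hab hbc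

theorem hb_of_po {a b : Event} (h : G.po a b) : G.hb a b := .single (.inl h)

theorem hb_of_sw {a b : Event} (h : G.sw a b) : G.hb a b := .single (.inr h)

theorem not_mem_W_of_mem_R {e : Event} (hR : e ∈ G.R) : e ∉ G.W := by
  rintro ⟨-, o, x, v, st, h⟩
  obtain ⟨-, o', x', v', s, h'⟩ := hR
  simp [h] at h'

theorem not_mem_F_of_mem_R {e : Event} (hR : e ∈ G.R) : e ∉ G.F := by
  rintro ⟨-, o, h⟩
  obtain ⟨-, o', x', v', s, h'⟩ := hR
  simp [h] at h'

theorem not_mem_F_of_mem_W {e : Event} (hW : e ∈ G.W) : e ∉ G.F := by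
  rintro ⟨-, o, h⟩
  obtain ⟨-, o', x', v', s, h'⟩ := hW
  simp [h] at h'

theorem Wrel_subset_W : G.Wrel ⊆ G.W := fun _ ⟨he, x, v, st, h⟩ => ⟨he, _, x, v, st, h⟩

theorem Racq_subset_R : G.Racq ⊆ G.R := fun _ ⟨he, x, v, s, h⟩ => ⟨he, _, x, v, s, h⟩

theorem Rex_subset_R : G.Rex ⊆ G.R := fun _ ⟨he, o, x, v, h⟩ => ⟨he, o, x, v, _, h⟩

theorem Frel_subset_FgeRel : G.Frel ⊆ G.FgeRel := fun _ ⟨he, h⟩ => ⟨he, Or.inl h⟩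

theorem Frel_subset_F : G.Frel ⊆ G.F := fun _ ⟨he, h⟩ => ⟨he, _, h⟩

theorem Fsc_subset_F : G.Fsc ⊆ G.F := fun _ ⟨he, h⟩ => ⟨he, _, h⟩

theorem FgeAcq_subset_F : G.FgeAcq ⊆ G.F := by
  rintro e ⟨he, h | h | h⟩ <;> exact ⟨he, _, h⟩

theorem po_of_rmw (hwf : ExecWf G) {a b : Event} (h : G.rmw a b) : G.po a b :=
  (hwf.rmw_sub a b h).2.2.2.1

/-! ### Synchronization -/

/-- What follows the release event, or the write after a release fence, in `sw`. -/
def relSuffix (G : Execution) : REv :=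
  G.rs ⬝ (G.rfi ∪ᵣ rcl G.poloc ⬝ G.rfe) ⬝ (⦗G.Racq⦘ ∪ᵣ G.po ⬝ ⦗G.FgeAcq⦘)

theorem sw_iff {a c : Event} : G.sw a c ↔
    (a ∈ G.Wrel ∧ G.relSuffix a c) ∨ (a ∈ G.FgeRel ∧ ∃ b, G.po a b ∧ G.relSuffix b c) := by
  constructor
  · rintro ⟨w, ⟨b, ⟨rfl, ha⟩ | ⟨_, ⟨rfl, ha⟩, hpo⟩, hrs⟩, h⟩
    · exact Or.inl ⟨ha, w, hrs, h⟩
    · exact Or.inr ⟨ha, b, hpo, w, hrs, h⟩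
  · rintro (⟨ha, w, hrs, h⟩ | ⟨ha, b, hpo, w, hrs, h⟩)
    · exact ⟨w, ⟨a, Or.inl ⟨rfl, ha⟩, hrs⟩, h⟩
    · exact ⟨w, ⟨b, Or.inr ⟨a, ⟨rfl, ha⟩, hpo⟩, hrs⟩, h⟩

theorem mem_Racq_or_F_of_relSuffix {a c : Event} (h : G.relSuffix a c) :
    c ∈ G.Racq ∨ c ∈ G.F := by
  obtain ⟨_, -, _, -, ⟨rfl, hR⟩ | ⟨_, -, rfl, hF⟩⟩ := h
  · exact Or.inl hR
  · exact Or.inr (FgeAcq_subset_F hF)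

theorem not_mem_W_of_relSuffix {a c : Event} (h : G.relSuffix a c) : c ∉ G.W := fun hW =>
  (mem_Racq_or_F_of_relSuffix h).elim
    (fun hR => not_mem_W_of_mem_R (Racq_subset_R hR) hW) (not_mem_F_of_mem_W hW)

theorem relSuffix_of_sw {a c : Event} (h : G.sw a c) : ∃ b, G.relSuffix b c := by
  rcases sw_iff.1 h with ⟨-, h⟩ | ⟨-, b, -, h⟩
  exacts [⟨a, h⟩, ⟨b, h⟩]

/-- If a release sequence is read by the read of an RMW pair, it extends to the write. -/
theorem rs_chain_of_relSuffix_rmw (hwf : ExecWf G) {a r b : Event} (h : G.relSuffix a r)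
    (hrb : G.rmw r b) :
    a ∈ G.W ∧ rtcl (rcl G.poloc ⬝ G.rf ⬝ G.rmw) a b := by
  obtain ⟨w, hrs, r', hrf, hacq⟩ := h
  have hr : r' = r := by
    rcases hacq with ⟨h, -⟩ | ⟨_, -, rfl, hF⟩
    · exact h
    · exact absurd (FgeAcq_subset_F hF)
        (not_mem_F_of_mem_R (Rex_subset_R (hwf.rmw_sub _ _ hrb).1))
  subst hr
  have hw : (rcl G.poloc ⬝ G.rf ⬝ G.rmw) w b := by
    rcases hrf with hrf | ⟨w', hw', hrf⟩
    · exact ⟨w, Or.inl rfl, r', hrf.1, hrb⟩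
    · exact ⟨w', hw', r', hrf.1, hrb⟩
  rcases hrs with ⟨_, ⟨rfl, ha⟩, _, haw, rfl, -⟩ | ⟨_, ⟨rfl, ha⟩, hch⟩
  · obtain ⟨w', hww', h⟩ := hw
    exact ⟨ha, .single ⟨w', rcl_trans (r := G.poloc) (fun _ _ _ => poloc_trans) (Or.inr haw) hww', h⟩⟩
  · exact ⟨ha, .tail hch hw⟩

/-- Synchronization through an RMW pair bypasses the pair, unless it stays in its thread. -/
theorem relSuffix_rmw_relSuffix (hwf : ExecWf G) {a r b d : Event} (h : G.relSuffix a r)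
    (hrb : G.rmw r b) (hbd : G.relSuffix b d) : G.relSuffix a d ∨ G.po r d := by
  obtain ⟨ha, hch⟩ := rs_chain_of_relSuffix_rmw hwf h hrb
  obtain ⟨w, ⟨_, ⟨rfl, -⟩, _, hbw, rfl, -⟩ | ⟨_, ⟨rfl, -⟩, hch'⟩, c, hwc, hcd⟩ := hbd
  · rcases hwc with hwc | ⟨w', hww', hwc⟩
    · right
      have hrc : G.po r c := po_trans (po_of_rmw hwf hrb) (po_trans hbw.1 hwc.2)
      rcases hcd with ⟨rfl, -⟩ | ⟨_, hcd, rfl, -⟩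
      · exact hrc
      · exact po_trans hrc hcd
    · exact Or.inl ⟨b, Or.inr ⟨a, ⟨rfl, ha⟩, hch⟩, c, Or.inr
        ⟨w', rcl_trans (r := G.poloc) (fun _ _ _ => poloc_trans) (Or.inr hbw) hww', hwc⟩, hcd⟩
  · exact Or.inl ⟨w, Or.inr ⟨a, ⟨rfl, ha⟩, hch.trans hch'⟩, c, hwc, hcd⟩

/-! ### Consequences of coherence along program order -/

theorem co_of_poloc (htot : ∀ x, totalOn (G.Wloc x) G.co)
    (hcoh : ∀ a b, G.po a b → ¬ G.eco b a) {a b : Event} (ha : a ∈ G.W) (hb : b ∈ G.W)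
    (hab : G.poloc a b) : G.co a b := by
  obtain ⟨hpo, x, hax, hbx⟩ := hab
  have hne : a ≠ b := by
    rintro rfl
    exact po_irrefl _ hpo
  rcases htot x a ⟨ha, hax⟩ b ⟨hb, hbx⟩ hne with h | h
  · exact h
  · exact absurd (Or.inl (Or.inr ⟨a, h, Or.inl rfl⟩)) (hcoh a b hpo)

theorem co_of_rf_rmw (hwf : ExecWf G) (htot : ∀ x, totalOn (G.Wloc x) G.co)
    (hcoh : ∀ a b, G.po a b → ¬ G.eco b a) {w r b : Event} (hrf : G.rf w r)
    (hrmw : G.rmw r b) : G.co w b := by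
  obtain ⟨hw, -, hwr⟩ := hwf.rf_sub _ _ hrf
  obtain ⟨-, hb, hrb, -⟩ := hwf.rmw_sub _ _ hrmw
  have hpo := po_of_rmw hwf hrmw
  obtain ⟨x, hwx, hbx⟩ := sameLoc_trans hwr hrb
  have hne : w ≠ b := by
    rintro rfl
    exact hcoh _ _ hpo (Or.inl (Or.inl hrf))
  rcases htot x w ⟨hw, hwx⟩ b ⟨hb, hbx⟩ hne with h | h
  · exact h
  · exact absurd (Or.inl (Or.inr ⟨w, h, Or.inr hrf⟩)) (hcoh _ _ hpo)

theorem rcl_co_of_rs (hwf : ExecWf G) (htot : ∀ x, totalOn (G.Wloc x) G.co)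
    (hcoh : ∀ a b, G.po a b → ¬ G.eco b a) {a b : Event} (h : G.rs a b) :
    b ∈ G.W ∧ rcl G.co a b := by
  rcases h with ⟨_, ⟨rfl, ha⟩, _, hab, rfl, hb⟩ | ⟨_, ⟨rfl, ha⟩, hch⟩
  · exact ⟨hb, Or.inr (co_of_poloc htot hcoh ha hb hab)⟩
  · induction hch with
    | refl => exact ⟨ha, Or.inl rfl⟩
    | tail _ hstep ih =>
      obtain ⟨w, hpw, r, hrf, hrmw⟩ := hstep
      have hw := (hwf.rf_sub _ _ hrf).1
      refine ⟨(hwf.rmw_sub _ _ hrmw).2.1, rcl_trans hwf.co_trans ih.2 ?_⟩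
      refine rcl_trans hwf.co_trans ?_ (Or.inr (co_of_rf_rmw hwf htot hcoh hrf hrmw))
      exact hpw.imp id (co_of_poloc htot hcoh ih.1 hw)

theorem exists_co_rf_of_relSuffix (hwf : ExecWf G) (htot : ∀ x, totalOn (G.Wloc x) G.co)
    (hcoh : ∀ a b, G.po a b → ¬ G.eco b a) {b d : Event} (h : G.relSuffix b d) :
    ∃ w r, rcl G.co b w ∧ G.rf w r ∧ rcl G.po r d := by
  obtain ⟨w, hrs, r, hwr, hrd⟩ := h
  have hrd' : rcl G.po r d := by
    rcases hrd with ⟨h, -⟩ | ⟨_, h, rfl, -⟩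
    · exact Or.inl h
    · exact Or.inr h
  obtain ⟨hw, hbw⟩ := rcl_co_of_rs hwf htot hcoh hrs
  rcases hwr with hwr | ⟨w', hww', hwr⟩
  · exact ⟨w, r, hbw, hwr.1, hrd'⟩
  · refine ⟨w', r, rcl_trans hwf.co_trans hbw ?_, hwr.1, hrd'⟩
    exact hww'.imp id (co_of_poloc htot hcoh hw (hwf.rf_sub _ _ hwr.1).1)

theorem co_or_fr_of_eco_mem_W (hwf : ExecWf G) {c b : Event} (h : G.eco c b)
    (hb : b ∈ G.W) : G.co c b ∨ G.fr c b := by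
  have hnrf : ∀ w, ¬ G.rf w b := fun w hw => not_mem_W_of_mem_R (hwf.rf_sub _ _ hw).2.1 hb
  rcases h with (h | ⟨w, h, rfl | hw⟩) | ⟨w, h, rfl | hw⟩
  exacts [absurd h (hnrf _), Or.inl h, absurd hw (hnrf _), Or.inr h, absurd hw (hnrf _)]

theorem fr_co (hwf : ExecWf G) {a b c : Event} (hab : G.fr a b) (hbc : G.co b c) :
    G.fr a c := by
  obtain ⟨w, hw, hwb⟩ := hab
  exact ⟨w, hw, hwf.co_trans hwb hbc⟩

theorem co_or_fr_of_eco_rmw (hwf : ExecWf G) (htot : ∀ x, totalOn (G.Wloc x) G.co)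
    (hcoh : ∀ a b, G.po a b → ¬ G.eco b a) {c r b : Event} (h : G.eco c r)
    (hrb : G.rmw r b) : G.co c b ∨ G.fr c b := by
  have hr : r ∉ G.W := not_mem_W_of_mem_R (Rex_subset_R (hwf.rmw_sub _ _ hrb).1)
  rcases h with (h | ⟨w, h, rfl | hw⟩) | ⟨w, ⟨w', h', h⟩, rfl | hw⟩
  · exact Or.inl (co_of_rf_rmw hwf htot hcoh h hrb)
  · exact absurd (hwf.co_sub _ _ h).2.1 hr
  · exact Or.inl (hwf.co_trans h (co_of_rf_rmw hwf htot hcoh hw hrb))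
  · exact absurd (hwf.co_sub _ _ h).2.1 hr
  · exact Or.inr ⟨w', h', hwf.co_trans h (co_of_rf_rmw hwf htot hcoh hw hrb)⟩

theorem eco_of_co_rf {b w r : Event} (hbw : rcl G.co b w) (hwr : G.rf w r) :
    G.eco b r := by
  rcases hbw with rfl | hbw
  · exact Or.inl (Or.inl hwr)
  · exact Or.inl (Or.inr ⟨w, hbw, Or.inr hwr⟩)

theorem eco_of_co_or_fr_co_rf (hwf : ExecWf G) {c b w r : Event} (hcb : G.co c b ∨ G.fr c b)
    (hbw : rcl G.co b w) (hwr : G.rf w r) : G.eco c r := by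
  rcases hcb with hcb | hcb
  · refine Or.inl (Or.inr ⟨w, ?_, Or.inr hwr⟩)
    rcases hbw with rfl | hbw
    exacts [hcb, hwf.co_trans hcb hbw]
  · refine Or.inr ⟨w, ?_, Or.inr hwr⟩
    rcases hbw with rfl | hbw
    exacts [hcb, fr_co hwf hcb hbw]

theorem not_eco_self_of_mem_R (hwf : ExecWf G) {r : Event} (hr : r ∈ G.R) : ¬ G.eco r r := by
  have hW := not_mem_W_of_mem_R hr
  rintro ((h | ⟨w, h, -⟩) | ⟨w, ⟨w', h', h⟩, rfl | hw⟩)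
  · exact hW (hwf.rf_sub _ _ h).1
  · exact hW (hwf.co_sub _ _ h).1
  · exact hW (hwf.co_sub _ _ h).2.1
  · obtain rfl := hwf.rf_func _ _ _ h' hw
    exact hwf.co_irr _ h

/-! ### Edges of `ar` into writes -/

theorem po_of_deps (hwf : ExecWf G) {a b : Event} (h : G.deps a b) : G.po a b := by
  rcases h with (((h | h) | ⟨c, h, rfl | hc⟩) | h) | ⟨_, ⟨rfl, -⟩, h⟩
  · exact (hwf.data_sub _ _ h).2.1
  · exact (hwf.ctrl_sub _ _ h).2
  · exact (hwf.addr_sub _ _ h).2.1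
  · exact po_trans (hwf.addr_sub _ _ h).2.1 hc
  · exact (hwf.casdep_sub _ _ h).2.1
  · exact h

theorem po_of_ppo (hwf : ExecWf G) {a b : Event} (h : G.ppo a b) : G.po a b := by
  obtain ⟨_, ⟨rfl, -⟩, _, h, rfl, -⟩ := h
  have hstep : ∀ {c d}, (G.deps ∪ᵣ G.rfi) c d → G.po c d :=
    fun h => h.elim (po_of_deps hwf) And.right
  induction h with
  | single h => exact hstep h
  | tail _ h ih => exact po_trans ih (hstep h)

theorem po_of_bob {a b : Event} (h : G.bob a b) : G.po a b := by
  rcases h with (((⟨_, h, rfl, -⟩ | ⟨_, ⟨rfl, -⟩, h⟩) | ⟨_, h, rfl, -⟩) | ⟨_, ⟨rfl, -⟩, h⟩) |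
    ⟨_, ⟨rfl, -⟩, _, h, rfl, -⟩
  exacts [h, h, h, h, h.1]

theorem po_of_ar_of_mem_W (hwf : ExecWf G) {a b : Event} (h : G.ar a b) (hb : b ∈ G.W) :
    G.po a b := by
  rcases h with ((((h | h) | h) | h) | ⟨_, -, _, -, _, -, _, -, rfl, hF⟩) |
    ⟨_, ⟨rfl, -⟩, _, h, rfl, -⟩
  · exact absurd hb (not_mem_W_of_mem_R (hwf.rf_sub _ _ h.1).2.1)
  · exact po_of_bob h
  · exact po_of_ppo hwf h
  · exact h.2
  · exact absurd (Fsc_subset_F hF) (not_mem_F_of_mem_W hb)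
  · exact h

theorem ppo_of_Rex_po_W {a b : Event} (ha : a ∈ G.Rex) (hab : G.po a b) (hb : b ∈ G.W) :
    G.ppo a b :=
  ⟨a, ⟨rfl, Rex_subset_R ha⟩, b, .single (.inl (.inr ⟨a, ⟨rfl, ha⟩, hab⟩)), rfl, hb⟩

theorem ar_of_ppo {a b : Event} (h : G.ppo a b) : G.ar a b := .inl (.inl (.inl (.inr h)))

theorem ar_of_po_F {a b : Event} (h : G.po a b) (hb : b ∈ G.F) : G.ar a b :=
  .inl (.inl (.inl (.inl (.inr (.inl (.inl (.inr ⟨b, h, rfl, hb⟩)))))))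

theorem ar_of_F_po {a b : Event} (ha : a ∈ G.F) (h : G.po a b) : G.ar a b :=
  .inl (.inl (.inl (.inl (.inr (.inl (.inr ⟨a, ⟨rfl, ha⟩, h⟩))))))

/-! ### Weakening of release writes -/

/-- The execution graph in which every release write is weakened to a relaxed one. -/
def weaken (G : Execution) : Execution :=
  { G with lab := fun e => weakenRelWrite (G.lab e) }

theorem weakenRelWrite_eq_read {l : Label} {o : Mode} {x : Loc} {v : Val} {s : ExFlag} :
    weakenRelWrite l = .read o x v s ↔ l = .read o x v s := by
  rcases l with _ | ⟨_ | _ | _ | _ | _, _, _, _⟩ | _ <;> simp [weakenRelWrite]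

theorem weakenRelWrite_eq_fence {l : Label} {o : Mode} :
    weakenRelWrite l = .fence o ↔ l = .fence o := by
  rcases l with _ | ⟨_ | _ | _ | _ | _, _, _, _⟩ | _ <;> simp [weakenRelWrite]

theorem exists_weakenRelWrite_eq_write {l : Label} {x : Loc} {v : Val} {st : Strength} :
    (∃ o, weakenRelWrite l = .write o x v st) ↔ ∃ o, l = .write o x v st := by
  rcases l with _ | ⟨_ | _ | _ | _ | _, _, _, _⟩ | _ <;> simp [weakenRelWrite]

theorem locOf_weakenRelWrite (l : Label) : (weakenRelWrite l).locOf = l.locOf := by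
  rcases l with _ | ⟨_ | _ | _ | _ | _, _, _, _⟩ | _ <;> rfl

theorem weaken_po : G.weaken.po = G.po := rfl

theorem weaken_loc : G.weaken.loc = G.loc := funext fun _ => locOf_weakenRelWrite _

theorem weaken_R : G.weaken.R = G.R := by
  simp only [R, weaken, weakenRelWrite_eq_read]

theorem weaken_F : G.weaken.F = G.F := by
  simp only [F, weaken, weakenRelWrite_eq_fence]

theorem weaken_Racq : G.weaken.Racq = G.Racq := by
  simp only [Racq, weaken, weakenRelWrite_eq_read]

theorem weaken_Rex : G.weaken.Rex = G.Rex := by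
  simp only [Rex, weaken, weakenRelWrite_eq_read]

theorem weaken_Fsc : G.weaken.Fsc = G.Fsc := by
  simp only [Fsc, weaken, weakenRelWrite_eq_fence]

theorem weaken_FgeRel : G.weaken.FgeRel = G.FgeRel := by
  simp only [FgeRel, weaken, weakenRelWrite_eq_fence]

theorem weaken_FgeAcq : G.weaken.FgeAcq = G.FgeAcq := by
  simp only [FgeAcq, weaken, weakenRelWrite_eq_fence]

theorem weaken_W : G.weaken.W = G.W := by
  ext e
  refine and_congr Iff.rfl ?_
  have h := @exists_weakenRelWrite_eq_write (G.lab e)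
  constructor
  · rintro ⟨o, x, v, st, hl⟩
    obtain ⟨o', hl'⟩ := h.1 ⟨o, hl⟩
    exact ⟨o', x, v, st, hl'⟩
  · rintro ⟨o, x, v, st, hl⟩
    obtain ⟨o', hl'⟩ := h.2 ⟨o, hl⟩
    exact ⟨o', x, v, st, hl'⟩

theorem weaken_Wstrong : G.weaken.Wstrong = G.Wstrong := by
  ext e
  refine and_congr Iff.rfl ?_
  have h := @exists_weakenRelWrite_eq_write (G.lab e)
  constructor
  · rintro ⟨o, x, v, hl⟩
    obtain ⟨o', hl'⟩ := h.1 ⟨o, hl⟩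
    exact ⟨o', x, v, hl'⟩
  · rintro ⟨o, x, v, hl⟩
    obtain ⟨o', hl'⟩ := h.2 ⟨o, hl⟩
    exact ⟨o', x, v, hl'⟩

theorem weaken_Wloc (x : Loc) : G.weaken.Wloc x = G.Wloc x := by
  simp only [Wloc, weaken_W, weaken_loc]

theorem weaken_poloc : G.weaken.poloc = G.poloc := by
  unfold poloc sameLoc
  rw [weaken_loc, weaken_po]

theorem weaken_rs : G.weaken.rs = G.rs := by
  simp only [rs, weaken_poloc, weaken_W]
  rfl

theorem weaken_relSuffix : G.weaken.relSuffix = G.relSuffix := by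
  simp only [relSuffix, weaken_rs, weaken_poloc, weaken_Racq, weaken_FgeAcq]
  rfl

theorem weaken_ppo : G.weaken.ppo = G.ppo := by
  simp only [ppo, deps, weaken_R, weaken_W, weaken_Rex]
  rfl

theorem weaken_sw_of_F_po {f b c : Event} (hf : f ∈ G.FgeRel) (hfb : G.po f b)
    (hbc : G.relSuffix b c) : G.weaken.sw f c :=
  sw_iff.2 (Or.inr ⟨by rwa [weaken_FgeRel], b, hfb, by rwa [weaken_relSuffix]⟩)

theorem weaken_sw_or_of_sw {a c : Event} (h : G.sw a c) :
    G.weaken.sw a c ∨ (a ∈ G.Wrel ∧ G.relSuffix a c) := by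
  rcases sw_iff.1 h with h | ⟨ha, b, hab, hbc⟩
  · exact Or.inr h
  · exact Or.inl (weaken_sw_of_F_po ha hab hbc)

/-- Between a release write and any event preceding it in program order there is a release
fence, unless the two form an RMW pair. -/
def RelWritesFenced (G : Execution) : Prop :=
  ∀ a b, G.po a b → b ∈ G.Wrel → (rcl G.po ⬝ ⦗G.Frel⦘ ⬝ G.po) a b ∨ G.rmw a b

/-- A happens-before path of `G` is one of the weakened graph, except possibly for a
synchronization edge out of a release write at its very beginning. -/
theorem hb_cases (hwf : ExecWf G) (hrel : G.RelWritesFenced) {a c : Event} (h : G.hb a c) :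
    G.weaken.hb a c ∨ ∃ b d, b ∈ G.Wrel ∧ (a = b ∨ G.rmw a b) ∧ G.relSuffix b d ∧
      rcl G.weaken.hb d c := by
  have hfence : ∀ {a f b d}, rcl G.po a f → f ∈ G.Frel → G.po f b → G.relSuffix b d →
      rcl G.weaken.hb d c → G.weaken.hb a c := by
    intro a f b d haf hf hfb hbd hdc
    have hfd := hb_of_sw (weaken_sw_of_F_po (Frel_subset_FgeRel hf) hfb hbd)
    have hfc : G.weaken.hb f c := by
      rcases hdc with rfl | hdc
      exacts [hfd, hb_trans hfd hdc]
    rcases haf with rfl | haf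
    exacts [hfc, hb_trans (hb_of_po haf) hfc]
  have hstep : ∀ {a d}, (G.po ∪ᵣ G.sw) a d →
      G.weaken.hb a d ∨ (a ∈ G.Wrel ∧ G.relSuffix a d) := by
    rintro a d (h | h)
    · exact Or.inl (hb_of_po h)
    · exact (weaken_sw_or_of_sw h).imp hb_of_sw id
  have hhead : ∀ {a d}, (G.po ∪ᵣ G.sw) a d → rcl G.weaken.hb d c →
      G.weaken.hb a c ∨ ∃ b d, b ∈ G.Wrel ∧ (a = b ∨ G.rmw a b) ∧ G.relSuffix b d ∧
        rcl G.weaken.hb d c := by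
    intro a d had hdc
    rcases hstep had with had | ⟨ha, had⟩
    · rcases hdc with rfl | hdc
      exacts [Or.inl had, Or.inl (hb_trans had hdc)]
    · exact Or.inr ⟨a, d, ha, Or.inl rfl, had, hdc⟩
  induction h using Relation.TransGen.head_induction_on with
  | single h => exact hhead h (Or.inl rfl)
  | @head a e hae _ ih =>
    rcases ih with ih | ⟨b, d, hb, rfl | heb, hbd, hdc⟩
    · exact hhead hae (Or.inr ih)
    · rcases hae with hae | hae
      · rcases hrel _ _ hae hb with ⟨f, haf, _, ⟨rfl, hf⟩, hfb⟩ | hrmw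
        · exact Or.inl (hfence haf hf hfb hbd hdc)
        · exact Or.inr ⟨e, d, hb, Or.inr hrmw, hbd, hdc⟩
      · obtain ⟨_, h⟩ := relSuffix_of_sw hae
        exact absurd (Wrel_subset_W hb) (not_mem_W_of_relSuffix h)
    · have hpoeb := po_of_rmw hwf heb
      rcases hae with hae | hae
      · rcases hrel _ _ (po_trans hae hpoeb) hb with ⟨f, haf, _, ⟨rfl, hf⟩, hfb⟩ | hrmw
        · exact Or.inl (hfence haf hf hfb hbd hdc)
        · exact absurd ⟨e, hae, hpoeb⟩ (hwf.rmw_sub _ _ hrmw).2.2.2.2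
      · have hpo : G.po e d → _ := fun hed => hhead (Or.inr hae)
          (rcl_trans (r := G.weaken.hb) (fun _ _ _ => hb_trans) (Or.inr (hb_of_po hed)) hdc)
        rcases sw_iff.1 hae with ⟨ha, hae'⟩ | ⟨ha, w, haw, hwe⟩
        · rcases relSuffix_rmw_relSuffix hwf hae' heb hbd with had | hed
          · exact Or.inr ⟨a, d, ha, Or.inl rfl, had, hdc⟩
          · exact hpo hed
        · rcases relSuffix_rmw_relSuffix hwf hwe heb hbd with hwd | hed
          · exact hhead (Or.inr (sw_iff.2 (Or.inr ⟨ha, w, haw, hwd⟩))) hdc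
          · exact hpo hed

theorem hb_irrefl_of_weaken (hwf : ExecWf G) (hrel : G.RelWritesFenced)
    (htot : ∀ x, totalOn (G.Wloc x) G.co) (hcoh : ∀ a b, G.weaken.hb a b → ¬ rcl G.eco b a) :
    Irreflexive (G.hb ⬝ rcl G.eco) := by
  have hcoh' : ∀ a b, G.po a b → ¬ G.eco b a :=
    fun a b h h' => hcoh a b (hb_of_po h) (Or.inr h')
  have hread : ∀ {r c}, r ∈ G.R → rcl G.weaken.hb r c → ¬ G.eco c r := by
    rintro r c hr (rfl | h) he
    exacts [not_eco_self_of_mem_R hwf hr he, hcoh _ _ h (Or.inr he)]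
  have htrans : ∀ a b c, G.weaken.hb a b → G.weaken.hb b c → G.weaken.hb a c :=
    fun _ _ _ => hb_trans
  rintro a ⟨c, hac, hca⟩
  rcases hb_cases hwf hrel hac with hac | ⟨b, d, hb, hab, hbd, hdc⟩
  · exact hcoh _ _ hac hca
  · obtain ⟨w, r, hbw, hwr, hrd⟩ := exists_co_rf_of_relSuffix hwf htot hcoh' hbd
    have hr := (hwf.rf_sub _ _ hwr).2.1
    have hrc : rcl G.weaken.hb r c := rcl_trans htrans (rcl_mono (fun _ _ => hb_of_po) hrd) hdc
    rcases hca with rfl | hca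
    · refine hread hr (rcl_trans htrans hrc ?_) (eco_of_co_rf hbw hwr)
      exact hab.imp id fun h => hb_of_po (po_of_rmw hwf h)
    · refine hread hr hrc (eco_of_co_or_fr_co_rf hwf (b := b) ?_ hbw hwr)
      rcases hab with rfl | hab
      · exact co_or_fr_of_eco_mem_W hwf hca (Wrel_subset_W hb)
      · exact co_or_fr_of_eco_rmw hwf htot hcoh' hca hab

theorem weaken_psc_of_psc (hwf : ExecWf G) (hrel : G.RelWritesFenced)
    (htot : ∀ x, totalOn (G.Wloc x) G.co) (hcoh : ∀ a b, G.po a b → ¬ G.eco b a)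
    {a b : Event} (h : G.psc a b) : G.weaken.psc a b := by
  obtain ⟨_, ⟨rfl, ha⟩, c, hac, e, hce, b', heb, hbb, hb⟩ := h
  subst hbb
  have hac' : G.weaken.hb a c := by
    rcases hb_cases hwf hrel hac with h | ⟨w, _, hw, rfl | hrmw, -, -⟩
    · exact h
    · exact absurd (Fsc_subset_F ha) (not_mem_F_of_mem_W (Wrel_subset_W hw))
    · exact absurd (Fsc_subset_F ha)
        (not_mem_F_of_mem_R (Rex_subset_R (hwf.rmw_sub _ _ hrmw).1))
  suffices ∃ e', G.eco c e' ∧ G.weaken.hb e' b' by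
    obtain ⟨e', hce', he'b⟩ := this
    refine ⟨a, ⟨rfl, by rwa [weaken_Fsc]⟩, c, hac', e', hce', b', he'b, rfl, ?_⟩
    rwa [weaken_Fsc]
  rcases hb_cases hwf hrel heb with h | ⟨x, d, hx, hex, hxd, hdb⟩
  · exact ⟨e, hce, h⟩
  · obtain ⟨w, r, hxw, hwr, hrd⟩ := exists_co_rf_of_relSuffix hwf htot hcoh hxd
    have hr := (hwf.rf_sub _ _ hwr).2.1
    refine ⟨r, eco_of_co_or_fr_co_rf hwf (b := x) ?_ hxw hwr, ?_⟩
    · rcases hex with rfl | hex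
      · exact co_or_fr_of_eco_mem_W hwf hce (Wrel_subset_W hx)
      · exact co_or_fr_of_eco_rmw hwf htot hcoh hce hex
    · rcases rcl_trans (r := G.weaken.hb) (fun _ _ _ => hb_trans)
        (rcl_mono (fun _ _ => hb_of_po) hrd) hdb with rfl | h
      · exact absurd (Fsc_subset_F hb) (not_mem_F_of_mem_R hr)
      · exact h

theorem weaken_ar_of_po_Wrel (hwf : ExecWf G) (hrel : G.RelWritesFenced) {a b c : Event}
    (hab : G.po a b) (hb : b ∈ G.Wrel) (hbc : rcl G.po b c) (hc : c ∈ G.W) :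
    tcl G.weaken.ar a c := by
  rcases hrel _ _ hab hb with ⟨f, haf, _, ⟨rfl, hf⟩, hfb⟩ | hrmw
  · have hF : f ∈ G.weaken.F := by
      rw [weaken_F]
      exact Frel_subset_F hf
    have hfc : G.po f c := by
      rcases hbc with rfl | hbc
      exacts [hfb, po_trans hfb hbc]
    exact tcl_of_head_rcl (haf.imp id fun h => ar_of_po_F h hF) (.single (ar_of_F_po hF hfc))
  · have hac : G.po a c := by
      rcases hbc with rfl | hbc
      exacts [hab, po_trans hab hbc]
    refine .single (ar_of_ppo ?_)
    rw [weaken_ppo]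
    exact ppo_of_Rex_po_W (hwf.rmw_sub _ _ hrmw).1 hac hc

theorem weaken_ar_or_of_ar (hwf : ExecWf G) (hrel : G.RelWritesFenced)
    (htot : ∀ x, totalOn (G.Wloc x) G.co) (hcoh : ∀ a b, G.po a b → ¬ G.eco b a)
    {a b : Event} (h : G.ar a b) :
    tcl G.weaken.ar a b ∨ (a ∈ G.Wrel ∧ G.po a b ∧ b ∈ G.W) := by
  rcases h with ((((h | h) | h) | h) | h) | ⟨_, ⟨rfl, hs⟩, b', h, hbb, hb⟩
  · exact Or.inl (.single (.inl (.inl (.inl (.inl (.inl h))))))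
  · rcases h with (((⟨_, h, rfl, hb⟩ | ⟨_, ⟨rfl, hR⟩, h⟩) | ⟨_, h, rfl, hF⟩) |
      ⟨_, ⟨rfl, hF⟩, h⟩) | ⟨_, ⟨rfl, ha⟩, _, h, rfl, hb⟩
    · exact Or.inl (weaken_ar_of_po_Wrel hwf hrel h hb (Or.inl rfl) (Wrel_subset_W hb))
    · rw [← weaken_Racq] at hR
      exact Or.inl (.single (.inl (.inl (.inl (.inl (.inr
        (.inl (.inl (.inl (.inr ⟨a, ⟨rfl, hR⟩, h⟩))))))))))
    · rw [← weaken_F] at hF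
      exact Or.inl (.single (ar_of_po_F h hF))
    · rw [← weaken_F] at hF
      exact Or.inl (.single (ar_of_F_po hF h))
    · exact Or.inr ⟨ha, h.1, hb⟩
  · rw [← weaken_ppo] at h
    exact Or.inl (.single (ar_of_ppo h))
  · exact Or.inl (.single (.inl (.inl (.inr h))))
  · exact Or.inl (.single (.inl (.inr (weaken_psc_of_psc hwf hrel htot hcoh h))))
  · subst hbb
    rw [← weaken_Wstrong] at hs
    rw [← weaken_W] at hb
    exact Or.inl (.single (.inr ⟨a, ⟨rfl, hs⟩, b', h, rfl, hb⟩))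

theorem ar_acyclic_of_weaken (hwf : ExecWf G) (hwf' : ExecWf G.weaken)
    (hrel : G.RelWritesFenced) (htot : ∀ x, totalOn (G.Wloc x) G.co)
    (hcoh : ∀ a b, G.po a b → ¬ G.eco b a) (hac : acyclic G.weaken.ar) : acyclic G.ar := by
  have hcases : ∀ {a c}, tcl G.ar a c → tcl G.weaken.ar a c ∨
      ∃ w, a ∈ G.Wrel ∧ G.po a w ∧ w ∈ G.W ∧ rtcl G.weaken.ar w c := by
    intro a c h
    induction h using Relation.TransGen.head_induction_on with
    | single h =>
      rcases weaken_ar_or_of_ar hwf hrel htot hcoh h with h | ⟨ha, hpo, hw⟩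
      · exact Or.inl h
      · exact Or.inr ⟨c, ha, hpo, hw, .refl⟩
    | @head a d had _ ih =>
      rcases ih with hdc | ⟨w, hd, hdw, hw, hwc⟩
      · rcases weaken_ar_or_of_ar hwf hrel htot hcoh had with had | ⟨ha, hpo, hw⟩
        · exact Or.inl (Relation.TransGen.trans had hdc)
        · exact Or.inr ⟨d, ha, hpo, hw, hdc.to_reflTransGen⟩
      · have hpo := po_of_ar_of_mem_W hwf had (Wrel_subset_W hd)
        exact Or.inl ((weaken_ar_of_po_Wrel hwf hrel hpo hd (Or.inr hdw) hw).trans_left hwc)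
  intro a h
  rcases hcases h with h | ⟨w, ha, haw, hw, hwa⟩
  · exact hac a h
  · rcases Relation.ReflTransGen.cases_tail hwa with rfl | ⟨e, hwe, hea⟩
    · exact po_irrefl _ haw
    · have hpo : G.po e a := po_of_ar_of_mem_W hwf' hea
        (by rw [weaken_W]; exact Wrel_subset_W ha)
      exact hac e ((weaken_ar_of_po_Wrel hwf hrel hpo ha (Or.inr haw) hw).trans_left hwe)

theorem immConsistent_of_weaken (hwf : ExecWf G) (hwf' : ExecWf G.weaken)
    (hrel : G.RelWritesFenced) (h : IMMConsistent G.weaken) : IMMConsistent G := by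
  obtain ⟨hrf, htot, hcoh, hatom, hac⟩ := h
  have htot' : ∀ x, totalOn (G.Wloc x) G.co := fun x => by
    rw [← weaken_Wloc]
    exact htot x
  have hcoh' : ∀ a b, G.weaken.hb a b → ¬ rcl G.eco b a := fun a b hab hba =>
    hcoh a ⟨b, hab, hba⟩
  exact ⟨hrf.trans weaken_R, htot', hb_irrefl_of_weaken hwf hrel htot' hcoh', hatom,
    ar_acyclic_of_weaken hwf hwf' hrel htot'
      (fun a b hab hba => hcoh' a b (hb_of_po hab) (Or.inr hba)) hac⟩

end Execution

/-- Theorem 4.1: if in `G` every release write is preceded by a release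
fence or is the write part of an RMW pair (`po;[W^rel] ⊆ po^?;[F^rel];po ∪ rmw`), and
`G'` is obtained from `G` by weakening the mode of every release write label to `rlx`
(all other components unchanged), then IMM-consistency of `G'` implies IMM-consistency
of `G`. -/
theorem release_write_split (G G' : Execution) (hwf : ExecWf G) (hwf' : ExecWf G')
    (hrel : ∀ a b, G.po a b → b ∈ G.Wrel →
      (rcl G.po ⬝ ⦗G.Frel⦘ ⬝ G.po) a b ∨ G.rmw a b)
    (hE : G'.E = G.E)
    (hlab : ∀ e, G'.lab e = weakenRelWrite (G.lab e))
    (hrmw : G'.rmw = G.rmw) (hdata : G'.data = G.data) (haddr : G'.addr = G.addr)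
    (hctrl : G'.ctrl = G.ctrl) (hcasdep : G'.casdep = G.casdep)
    (hrf : G'.rf = G.rf) (hco : G'.co = G.co) :
    IMMConsistent G' → IMMConsistent G := by
  have hG : G' = G.weaken := by
    cases G'
    simp only at hE hlab hrmw hdata haddr hctrl hcasdep hrf hco
    obtain rfl := funext hlab
    subst_vars
    rfl
  subst hG
  exact Execution.immConsistent_of_weaken hwf hwf' hrel
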